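/- Consider a two-player extensive-form game (as in the model below) satisfying perfect recall. Then Ξ = 𝒱 if and only if every extreme point of 𝒱 has all coordinates in {0, 1}. -/

import Mathlib

open scoped Classical

/-- The type of "sequences" of a player: `none` is the empty sequence `∅`, and
`some (I, a)` is the sequence consisting of information set `I` (a set of nodes)
together with action `a` at `I`. -/
abbrev SeqP := Option (Set (List ℕ) × ℕ)

/-- The type of (candidate) reduced-normal-form plans: partial functions from
information sets to actions, encoded with `Option`. -/
abbrev PlanT := Set (List ℕ) → Option ℕ

/-- Two information sets (of the two players) are connected, `I ⇌ J`, if some node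
of one is a prefix of some node of the other. -/
def Connected (I J : Set (List ℕ)) : Prop := ∃ u ∈ I, ∃ v ∈ J, u <+: v ∨ v <+: u

/-- A two-player extensive-form game.  Nodes are histories (finite lists of naturals),
`H` is the finite, prefix-closed set of nodes.  The two players are `0` and `1`
(as elements of `Fin 2`, embedded into `Fin 3` via `Fin.castSucc`), and an internal
node `u` with `owner u = 2` is a chance node.  `sim i` is the information-partition
equivalence relation of player `i` on the internal nodes owned by player `i`. -/
structure EFG where
  H : Finset (List ℕ)
  root_mem : ([] : List ℕ) ∈ H
  prefix_closed : ∀ u v : List ℕ, u <+: v → v ∈ H → u ∈ H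
  owner : List ℕ → Fin 3
  sim : Fin 2 → List ℕ → List ℕ → Prop
  sim_mem : ∀ i u v, sim i u v → (∃ a, u ++ [a] ∈ H) ∧ owner u = Fin.castSucc i
  sim_refl : ∀ i u, (∃ a, u ++ [a] ∈ H) → owner u = Fin.castSucc i → sim i u u
  sim_symm : ∀ i u v, sim i u v → sim i v u
  sim_trans : ∀ i u v w, sim i u v → sim i v w → sim i u w
  sim_actions : ∀ i u v, sim i u v → ∀ a : ℕ, u ++ [a] ∈ H ↔ v ++ [a] ∈ H

namespace EFG

variable (G : EFG)

/-- A node is internal if it has at least one child in the tree. -/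
def Internal (u : List ℕ) : Prop := ∃ a, u ++ [a] ∈ G.H

/-- The (finite) set of actions `A(u) = {a : u ++ [a] ∈ H}` available at node `u`. -/
noncomputable def actions (u : List ℕ) : Finset ℕ :=
  (G.H.finite_toSet.preimage (f := fun a : ℕ => u ++ [a])
    (fun a _ b _ hab => by simpa using hab)).toFinset

/-- `I` is an information set of player `i`: an equivalence class of `sim i`. -/
def InfoSet (i : Fin 2) (I : Set (List ℕ)) : Prop :=
  ∃ u, G.sim i u u ∧ I = {v | G.sim i u v}

/-- `seqᵢ(u)`: the list (ordered by increasing length of the prefix `w`) of pairs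
`(I, a)` such that `w ++ [a] ≼ u` for some internal node `w` owned by player `i`
whose information set is `I`. -/
noncomputable def playerSeq (i : Fin 2) (u : List ℕ) : List (Set (List ℕ) × ℕ) :=
  (List.range u.length).filterMap fun k =>
    if G.Internal (u.take k) ∧ G.owner (u.take k) = Fin.castSucc i then
      some ({v | G.sim i (u.take k) v}, u.getD k 0)
    else none

/-- Perfect recall: nodes in the same information set have the same player sequence. -/
def PerfectRecall : Prop := ∀ i u v, G.sim i u v → G.playerSeq i u = G.playerSeq i v

/-- The parent sequence `σ(I)` of an information set `I` of player `i`: the last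
element of `seqᵢ(u)` for `u ∈ I` (`none` encodes the empty sequence `∅`). -/
noncomputable def parentSeq (i : Fin 2) (I : Set (List ℕ)) : SeqP :=
  if h : ∃ u, u ∈ I then (G.playerSeq i h.choose).getLast? else none

/-- All chance moves are public: any two nodes in the same information set have
the same set of chance moves (pairs of a chance node and an action) on their paths. -/
def PublicChance : Prop :=
  ∀ i u v, G.sim i u v →
    {p : List ℕ × ℕ | G.Internal p.1 ∧ G.owner p.1 = 2 ∧ p.1 ++ [p.2] <+: u} =
    {p : List ℕ × ℕ | G.Internal p.1 ∧ G.owner p.1 = 2 ∧ p.1 ++ [p.2] <+: v}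

/-- Triangle-freeness of the game. -/
def TriangleFree : Prop :=
  ¬ ∃ I₁ I₂ J₁ J₂ : Set (List ℕ),
      G.InfoSet 0 I₁ ∧ G.InfoSet 0 I₂ ∧ G.InfoSet 1 J₁ ∧ G.InfoSet 1 J₂ ∧
      I₁ ≠ I₂ ∧ J₁ ≠ J₂ ∧
      G.parentSeq 0 I₁ = G.parentSeq 0 I₂ ∧ G.parentSeq 1 J₁ = G.parentSeq 1 J₂ ∧
      Connected I₁ J₁ ∧ Connected I₂ J₂ ∧ Connected I₁ J₂

/-- `σ` is a member of `Σᵢ`, the set of sequences of player `i`. -/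
def IsSeq (i : Fin 2) (σ : SeqP) : Prop :=
  σ = none ∨ ∃ I a, σ = some (I, a) ∧ G.InfoSet i I ∧ ∃ u ∈ I, u ++ [a] ∈ G.H

/-- `(σ₁, σ₂)` is a relevant sequence pair, `σ₁ ⇌ σ₂`. -/
def RelPair (σ₁ σ₂ : SeqP) : Prop :=
  G.IsSeq 0 σ₁ ∧ G.IsSeq 1 σ₂ ∧
    (σ₁ = none ∨ σ₂ = none ∨
      ∃ I₁ a₁ I₂ a₂, σ₁ = some (I₁, a₁) ∧ σ₂ = some (I₂, a₂) ∧ Connected I₁ I₂)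

/-- `σ₂ ∈ Σ₂` is relevant for the player-1 information set `I₁`. -/
def RelFor₁ (σ₂ : SeqP) (I₁ : Set (List ℕ)) : Prop :=
  σ₂ = none ∨ ∃ I₂ a₂, σ₂ = some (I₂, a₂) ∧ Connected I₁ I₂

/-- `σ₁ ∈ Σ₁` is relevant for the player-2 information set `I₂`. -/
def RelFor₂ (σ₁ : SeqP) (I₂ : Set (List ℕ)) : Prop :=
  σ₁ = none ∨ ∃ I₁ a₁, σ₁ = some (I₁, a₁) ∧ Connected I₁ I₂

/-- The index set of correlation plans: the relevant sequence pairs `Σ₁ ⇌ Σ₂`. -/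
abbrev Idx := {p : SeqP × SeqP // G.RelPair p.1 p.2}

/-- The entry of a vector `v` indexed by relevant pairs at the pair `(σ₁, σ₂)`
(and `0` at irrelevant pairs, which never occur in the constraints below). -/
noncomputable def val (v : G.Idx → ℝ) (σ₁ σ₂ : SeqP) : ℝ :=
  if h : G.RelPair σ₁ σ₂ then v ⟨(σ₁, σ₂), h⟩ else 0

/-- The von Stengel–Forges polytope `𝒱`. -/
def VSF : Set (G.Idx → ℝ) :=
  {v | (∀ p, 0 ≤ v p) ∧
    G.val v none none = 1 ∧
    (∀ I₁, G.InfoSet 0 I₁ → ∀ σ₂, G.IsSeq 1 σ₂ → RelFor₁ σ₂ I₁ → ∀ u ∈ I₁,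
      ∑ a ∈ G.actions u, G.val v (some (I₁, a)) σ₂ = G.val v (G.parentSeq 0 I₁) σ₂) ∧
    (∀ I₂, G.InfoSet 1 I₂ → ∀ σ₁, G.IsSeq 0 σ₁ → RelFor₂ σ₁ I₂ → ∀ u ∈ I₂,
      ∑ a ∈ G.actions u, G.val v σ₁ (some (I₂, a)) = G.val v σ₁ (G.parentSeq 1 I₂))}

/-- `π` is a reduced-normal-form plan for player `i`. -/
def IsPlan (i : Fin 2) (π : PlanT) : Prop :=
  (∀ I, ¬ G.InfoSet i I → π I = none) ∧
  (∀ I, G.InfoSet i I →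
    ((π I).isSome = true ↔ ∀ u ∈ I, ∀ p ∈ G.playerSeq i u, π p.1 = some p.2)) ∧
  (∀ I a, G.InfoSet i I → π I = some a → ∃ u ∈ I, u ++ [a] ∈ G.H)

/-- `Πᵢ(σ)`: the set of reduced-normal-form plans of player `i` compatible with `σ`. -/
def PlanSet (i : Fin 2) : SeqP → Set PlanT
  | none => {π | G.IsPlan i π}
  | some (I, a) => {π | G.IsPlan i π ∧ π I = some a}

/-- `μ` is a probability distribution on `Π₁ × Π₂`. -/
def IsDist (μ : PlanT × PlanT → ℝ) : Prop :=
  (∀ q, 0 ≤ μ q) ∧ (Function.support μ).Finite ∧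
  (∀ q, μ q ≠ 0 → G.IsPlan 0 q.1 ∧ G.IsPlan 1 q.2) ∧
  ∑ᶠ q, μ q = 1

/-- The linear map `f` from distributions on `Π₁ × Π₂` to correlation plans. -/
noncomputable def corrMap (μ : PlanT × PlanT → ℝ) : G.Idx → ℝ :=
  fun p => ∑ᶠ q ∈ {q : PlanT × PlanT | q.1 ∈ G.PlanSet 0 p.1.1 ∧ q.2 ∈ G.PlanSet 1 p.1.2}, μ q

/-- The polytope of correlation plans `Ξ`: the image of the probability distributions
on `Π₁ × Π₂` under `f`. -/
def corrPoly : Set (G.Idx → ℝ) := {x | ∃ μ, G.IsDist μ ∧ x = G.corrMap μ}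

/-- The `σ₁`-rank of a player-2 information set `I₂`: the number of player-1
information sets connected to `I₂` whose parent sequence is `σ₁`. -/
noncomputable def rank₁ (σ₁ : SeqP) (I₂ : Set (List ℕ)) : ℕ :=
  Nat.card {J : Set (List ℕ) // G.InfoSet 0 J ∧ Connected J I₂ ∧ G.parentSeq 0 J = σ₁}

/-- The `σ₂`-rank of a player-1 information set `I₁`: the number of player-2
information sets connected to `I₁` whose parent sequence is `σ₂`. -/
noncomputable def rank₂ (σ₂ : SeqP) (I₁ : Set (List ℕ)) : ℕ :=
  Nat.card {J : Set (List ℕ) // G.InfoSet 1 J ∧ Connected I₁ J ∧ G.parentSeq 1 J = σ₂}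

end EFG

/-- The point-mass distribution `𝟙_{q₀}` on pairs of plans. -/
noncomputable def pointMass (q₀ : PlanT × PlanT) : PlanT × PlanT → ℝ :=
  fun q => if q = q₀ then 1 else 0

namespace EFG

variable {G : EFG} {i : Fin 2}

theorem mem_actions {u : List ℕ} {a : ℕ} : a ∈ G.actions u ↔ u ++ [a] ∈ G.H := by
  simp [actions]

theorem InfoSet.eq_class {I : Set (List ℕ)} (hI : G.InfoSet i I) {u : List ℕ} (hu : u ∈ I) :
    I = {v | G.sim i u v} := by
  obtain ⟨w, -, rfl⟩ := hI
  ext v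
  exact ⟨fun h => G.sim_trans _ _ _ _ (G.sim_symm _ _ _ hu) h,
    fun h => G.sim_trans _ _ _ _ hu h⟩

theorem InfoSet.exists_mem {I : Set (List ℕ)} (hI : G.InfoSet i I) : ∃ u, u ∈ I := by
  obtain ⟨w, hw, rfl⟩ := hI
  exact ⟨w, hw⟩

theorem InfoSet.sim {I : Set (List ℕ)} (hI : G.InfoSet i I) {u v : List ℕ} (hu : u ∈ I)
    (hv : v ∈ I) : G.sim i u v := by
  rw [hI.eq_class hu] at hv
  exact hv

theorem InfoSet.mem_H {I : Set (List ℕ)} (hI : G.InfoSet i I) {u : List ℕ} (hu : u ∈ I) :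
    u ∈ G.H := by
  obtain ⟨⟨a, ha⟩, -⟩ := G.sim_mem _ _ _ (hI.sim hu hu)
  exact G.prefix_closed _ _ (List.prefix_append _ _) ha

theorem isSeq_some {I : Set (List ℕ)} {a : ℕ} :
    G.IsSeq i (some (I, a)) ↔ G.InfoSet i I ∧ ∃ u ∈ I, u ++ [a] ∈ G.H := by
  constructor
  · rintro (h | ⟨J, b, h, hJ⟩)
    · cases h
    · cases h
      exact hJ
  · exact fun h => Or.inr ⟨I, a, rfl, h⟩

theorem isSeq_some_iff_mem_actions {I : Set (List ℕ)} (hI : G.InfoSet i I) {u : List ℕ}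
    (hu : u ∈ I) {a : ℕ} : G.IsSeq i (some (I, a)) ↔ a ∈ G.actions u := by
  rw [isSeq_some, mem_actions]
  constructor
  · rintro ⟨-, v, hv, h⟩
    exact (G.sim_actions i v u (hI.sim hv hu) a).1 h
  · exact fun h => ⟨hI, u, hu, h⟩

theorem playerSeq_append_singleton (u : List ℕ) (a : ℕ) :
    G.playerSeq i (u ++ [a]) = G.playerSeq i u ++
      if G.Internal u ∧ G.owner u = Fin.castSucc i then [({v | G.sim i u v}, a)] else [] := by
  unfold playerSeq
  rw [List.length_append, List.length_singleton, List.range_succ, List.filterMap_append]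
  congr 1
  · apply List.filterMap_congr
    intro k hk
    rw [List.mem_range] at hk
    rw [List.take_append_of_le_length hk.le, List.getD_append _ _ _ _ hk]
  · rw [List.filterMap_cons, List.filterMap_nil, List.take_left,
      List.getD_append_right _ _ _ _ le_rfl]
    split_ifs <;> simp

/-- A nonempty player sequence ends with the last move of that player, made at a node `w`. -/
theorem playerSeq_cases {u : List ℕ} (hu : u ∈ G.H) :
    G.playerSeq i u = [] ∨ ∃ w a, G.sim i w w ∧ w ++ [a] <+: u ∧
      G.playerSeq i u = G.playerSeq i w ++ [({v | G.sim i w v}, a)] := by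
  induction u using List.reverseRecOn with
  | nil => left; rfl
  | append_singleton u a ih =>
    rw [playerSeq_append_singleton]
    split_ifs with h
    · exact Or.inr ⟨u, a, G.sim_refl i u h.1 h.2, List.prefix_rfl, rfl⟩
    · rw [List.append_nil]
      refine (ih (G.prefix_closed _ _ (List.prefix_append _ _) hu)).imp_right ?_
      rintro ⟨w, b, hw, hp, he⟩
      exact ⟨w, b, hw, hp.trans (List.prefix_append _ _), he⟩

theorem parentSeq_eq (hpr : G.PerfectRecall) {I : Set (List ℕ)} (hI : G.InfoSet i I)
    {u : List ℕ} (hu : u ∈ I) : G.parentSeq i I = (G.playerSeq i u).getLast? := by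
  have h : ∃ u, u ∈ I := ⟨u, hu⟩
  rw [parentSeq, dif_pos h, hpr i _ _ (hI.sim h.choose_spec hu)]

theorem parentSeq_cases (hpr : G.PerfectRecall) {I : Set (List ℕ)} (hI : G.InfoSet i I)
    {u : List ℕ} (hu : u ∈ I) :
    (G.parentSeq i I = none ∧ G.playerSeq i u = []) ∨
    ∃ I' a' u', G.parentSeq i I = some (I', a') ∧ G.InfoSet i I' ∧ u' ∈ I' ∧
      u' ++ [a'] <+: u ∧ G.playerSeq i u = G.playerSeq i u' ++ [(I', a')] := by
  rw [parentSeq_eq hpr hI hu]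
  rcases playerSeq_cases (i := i) (hI.mem_H hu) with h | ⟨w, a, hw, hp, h⟩
  · exact Or.inl ⟨by rw [h]; rfl, h⟩
  · exact Or.inr ⟨_, a, w, by rw [h]; simp, ⟨w, hw, rfl⟩, hw, hp, h⟩

theorem isSeq_parentSeq (hpr : G.PerfectRecall) {I : Set (List ℕ)} (hI : G.InfoSet i I) :
    G.IsSeq i (G.parentSeq i I) := by
  obtain ⟨u, hu⟩ := hI.exists_mem
  rcases parentSeq_cases hpr hI hu with ⟨h, -⟩ | ⟨I', a', u', h, hI', hu', hp, -⟩
  · exact Or.inl h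
  · rw [h, isSeq_some]
    exact ⟨hI', u', hu', G.prefix_closed _ _ hp (hI.mem_H hu)⟩

/-- Induction along the tree of information sets of a player. -/
theorem infoSet_induction (hpr : G.PerfectRecall) {P : Set (List ℕ) → Prop}
    (step : ∀ I, G.InfoSet i I →
      (∀ I' a', G.parentSeq i I = some (I', a') → G.InfoSet i I' → P I') → P I)
    {I : Set (List ℕ)} (hI : G.InfoSet i I) : P I := by
  obtain ⟨u, hu⟩ := hI.exists_mem
  induction hn : (G.playerSeq i u).length using Nat.strong_induction_on generalizing I u with
  | _ n ih =>
    refine step I hI fun I' a' h hI' => ?_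
    rcases parentSeq_cases hpr hI hu with ⟨h₀, -⟩ | ⟨J, b, u', h₀, -, hu', -, hs⟩
    · rw [h₀] at h
      cases h
    · rw [h₀] at h
      cases h
      refine ih _ ?_ hI' u' hu' rfl
      rw [← hn, hs]
      simp

theorem connected_comm {I J : Set (List ℕ)} : Connected I J ↔ Connected J I :=
  ⟨fun ⟨u, hu, v, hv, h⟩ => ⟨v, hv, u, hu, h.symm⟩,
    fun ⟨u, hu, v, hv, h⟩ => ⟨v, hv, u, hu, h.symm⟩⟩

theorem Connected.parent (hpr : G.PerfectRecall) {I J I' : Set (List ℕ)} {a' : ℕ}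
    (hI : G.InfoSet i I) (hp : G.parentSeq i I = some (I', a')) (h : Connected I J) :
    Connected I' J := by
  obtain ⟨u, hu, v, hv, h⟩ := h
  rcases parentSeq_cases hpr hI hu with ⟨h₀, -⟩ | ⟨I₁, a₁, u', h₀, -, hu', hpre, -⟩
  · rw [h₀] at hp
    cases hp
  · rw [h₀] at hp
    cases hp
    have hu'u : u' <+: u := (List.prefix_append _ _).trans hpre
    refine ⟨u', hu', v, hv, ?_⟩
    rcases h with h | h
    · exact Or.inl (hu'u.trans h)
    · exact List.prefix_or_prefix_of_prefix hu'u h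

/-- `x` is a nonnegative function on the sequences of player `i`, vanishing away from the
information sets satisfying `R`, and satisfying the sequence-form constraints at those. -/
structure IsFlow (G : EFG) (i : Fin 2) (R : Set (List ℕ) → Prop) (x : SeqP → ℝ) : Prop where
  nonneg : ∀ σ, 0 ≤ x σ
  eq_zero : ∀ I a, ¬ (R I ∧ G.IsSeq i (some (I, a))) → x (some (I, a)) = 0
  sum_eq : ∀ I, G.InfoSet i I → R I → ∀ u ∈ I,
    ∑ a ∈ G.actions u, x (some (I, a)) = x (G.parentSeq i I)

namespace IsFlow

variable {R : Set (List ℕ) → Prop} {x : SeqP → ℝ}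

theorem le_parent (hx : G.IsFlow i R x) {I : Set (List ℕ)} (hI : G.InfoSet i I) (a : ℕ) :
    x (some (I, a)) ≤ x (G.parentSeq i I) := by
  by_cases h : R I ∧ G.IsSeq i (some (I, a))
  · obtain ⟨u, hu⟩ := hI.exists_mem
    rw [← hx.sum_eq I hI h.1 u hu]
    exact Finset.single_le_sum (f := fun a => x (some (I, a))) (fun _ _ => hx.nonneg _)
      ((isSeq_some_iff_mem_actions hI hu).1 h.2)
  · rw [hx.eq_zero I a h]
    exact hx.nonneg _

theorem le_none (hpr : G.PerfectRecall) (hx : G.IsFlow i R x) (σ : SeqP) : x σ ≤ x none := by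
  rcases σ with _ | ⟨I, a⟩
  · exact le_rfl
  by_cases hs : G.IsSeq i (some (I, a))
  · refine infoSet_induction hpr (P := fun I => ∀ a, x (some (I, a)) ≤ x none) ?_
      (isSeq_some.1 hs).1 a
    intro I hI ih a
    refine (hx.le_parent hI a).trans ?_
    obtain ⟨u, hu⟩ := hI.exists_mem
    rcases parentSeq_cases hpr hI hu with ⟨h, -⟩ | ⟨I', a', u', h, hI', -⟩
    · rw [h]
    · rw [h]
      exact ih I' a' h hI' a'
  · rw [hx.eq_zero I a fun h => hs h.2]
    exact hx.nonneg _

theorem unique_action (hx : G.IsFlow i R x) (h1 : ∀ σ, x σ ≤ 1)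
    {I : Set (List ℕ)} {a b : ℕ} (ha : x (some (I, a)) = 1) (hb : x (some (I, b)) ≠ 0) :
    a = b := by
  by_contra hab
  have hRa : R I ∧ G.IsSeq i (some (I, a)) := by
    by_contra h
    rw [hx.eq_zero I a h] at ha
    exact zero_ne_one ha
  have hRb : R I ∧ G.IsSeq i (some (I, b)) := by
    by_contra h
    exact hb (hx.eq_zero I b h)
  have hI := (isSeq_some.1 hRa.2).1
  obtain ⟨u, hu⟩ := hI.exists_mem
  have hsum := hx.sum_eq I hI hRa.1 u hu
  have hle : ∑ c ∈ {a, b}, x (some (I, c)) ≤ ∑ c ∈ G.actions u, x (some (I, c)) := by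
    refine Finset.sum_le_sum_of_subset_of_nonneg ?_ fun _ _ _ => hx.nonneg _
    rw [Finset.insert_subset_iff, Finset.singleton_subset_iff]
    exact ⟨(isSeq_some_iff_mem_actions hI hu).1 hRa.2,
      (isSeq_some_iff_mem_actions hI hu).1 hRb.2⟩
  rw [Finset.sum_pair hab] at hle
  have := h1 (G.parentSeq i I)
  have := (hx.nonneg (some (I, b))).lt_of_ne' hb
  linarith

/-- If a flow has value one at the parent of `I`, then it has value one along the path to `I`. -/
theorem eq_one_of_mem_playerSeq (hpr : G.PerfectRecall) (hx : G.IsFlow i R x)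
    (h1 : ∀ σ, x σ ≤ 1) {I : Set (List ℕ)} (hI : G.InfoSet i I)
    (hp : x (G.parentSeq i I) = 1) :
    ∀ u ∈ I, ∀ p ∈ G.playerSeq i u, x (some p) = 1 := by
  refine infoSet_induction hpr (P := fun I => x (G.parentSeq i I) = 1 →
    ∀ u ∈ I, ∀ p ∈ G.playerSeq i u, x (some p) = 1) ?_ hI hp
  intro I hI ih hp u hu p hmem
  rcases parentSeq_cases hpr hI hu with ⟨-, hs⟩ | ⟨I', a', u', h, hI', hu', -, hs⟩
  · rw [hs] at hmem
    simp at hmem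
  · rw [h] at hp
    rw [hs, List.mem_append, List.mem_singleton] at hmem
    rcases hmem with hmem | rfl
    · exact ih I' a' h hI' (le_antisymm (h1 _) (hp ▸ hx.le_parent hI' a')) u' hu' p hmem
    · exact hp

/-- A zero-one flow is the indicator of a plan. -/
theorem exists_plan (hpr : G.PerfectRecall) (hx : G.IsFlow i (fun _ => True) x)
    (h01 : ∀ σ, x σ = 0 ∨ x σ = 1) (hnone : x none = 1) :
    ∃ π, G.IsPlan i π ∧ ∀ I a, π I = some a ↔ x (some (I, a)) = 1 := by
  have h1 : ∀ σ, x σ ≤ 1 := fun σ => hnone ▸ hx.le_none hpr σ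
  let π : PlanT := fun I => if h : ∃ a, x (some (I, a)) = 1 then some h.choose else none
  have hπ : ∀ I a, π I = some a ↔ x (some (I, a)) = 1 := by
    intro I a
    by_cases h : ∃ a, x (some (I, a)) = 1
    · simp only [π, dif_pos h, Option.some.injEq]
      constructor
      · rintro rfl
        exact h.choose_spec
      · intro ha
        exact hx.unique_action h1 h.choose_spec (by rw [ha]; exact one_ne_zero)
    · simp only [π, dif_neg h, reduceCtorEq, false_iff]
      exact fun ha => h ⟨a, ha⟩
  have hseq : ∀ I a, π I = some a → G.IsSeq i (some (I, a)) := by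
    intro I a ha
    by_contra h
    rw [hπ, hx.eq_zero I a fun h' => h h'.2] at ha
    exact zero_ne_one ha
  refine ⟨π, ⟨?_, ?_, ?_⟩, hπ⟩
  · intro I hI
    by_contra h
    obtain ⟨a, ha⟩ := Option.ne_none_iff_exists'.1 h
    exact hI (isSeq_some.1 (hseq I a ha)).1
  · intro I hI
    obtain ⟨u, hu⟩ := hI.exists_mem
    constructor
    · intro h v hv p hp
      obtain ⟨a, ha⟩ := Option.isSome_iff_exists.1 h
      rw [hπ] at ha ⊢
      exact hx.eq_one_of_mem_playerSeq hpr h1 hI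
        (le_antisymm (h1 _) (ha ▸ hx.le_parent hI a)) v hv p hp
    · intro h
      have hpar : x (G.parentSeq i I) = 1 := by
        rcases parentSeq_cases hpr hI hu with ⟨h₀, -⟩ | ⟨I', a', u', h₀, -, -, -, hs⟩
        · rw [h₀, hnone]
        · rw [h₀, ← hπ]
          exact h u hu (I', a') (by rw [hs]; simp)
      rw [← hx.sum_eq I hI trivial u hu] at hpar
      obtain ⟨a, -, ha⟩ := Finset.exists_ne_zero_of_sum_ne_zero
        (by rw [hpar]; exact one_ne_zero)
      exact Option.isSome_iff_exists.2 ⟨a, (hπ I a).2 ((h01 _).resolve_left ha)⟩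
  · intro I a _ ha
    exact (isSeq_some.1 (hseq I a ha)).2

/-- A flow with initial value one, dominated by a zero-one flow `y`, is one wherever `y` is,
as far as it is allowed to be nonzero. -/
theorem eq_one_of_le (hpr : G.PerfectRecall) {y : SeqP → ℝ} (hx : G.IsFlow i R x)
    (hR : ∀ I I' a', G.InfoSet i I → R I → G.parentSeq i I = some (I', a') → R I')
    (hxnone : x none = 1) (hy : G.IsFlow i (fun _ => True) y) (hy1 : ∀ σ, y σ ≤ 1)
    (hle : ∀ σ, x σ ≤ y σ) {I : Set (List ℕ)} {a : ℕ} (hI : G.InfoSet i I) (hRI : R I)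
    (ha : y (some (I, a)) = 1) : x (some (I, a)) = 1 := by
  refine infoSet_induction hpr (P := fun I => R I → ∀ a, y (some (I, a)) = 1 →
    x (some (I, a)) = 1) ?_ hI hRI a ha
  intro I hI ih hRI a ha
  obtain ⟨u, hu⟩ := hI.exists_mem
  have hpar : x (G.parentSeq i I) = 1 := by
    rcases parentSeq_cases hpr hI hu with ⟨h, -⟩ | ⟨I', a', u', h, hI', -⟩
    · rw [h, hxnone]
    · have := hy.le_parent hI a
      rw [ha, h] at this
      rw [h]
      exact ih I' a' h hI' (hR I I' a' hI hRI h) a' (le_antisymm (hy1 _) this)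
  rw [← hx.sum_eq I hI hRI u hu] at hpar
  rw [← hpar]
  refine (Finset.sum_eq_single (f := fun b => x (some (I, b))) a ?_ ?_).symm
  · intro b _ hba
    by_contra hb
    refine hba (hy.unique_action hy1 ha ?_).symm
    exact (((hx.nonneg _).lt_of_ne' hb).trans_le (hle _)).ne'
  · intro h
    refine hx.eq_zero I a fun h' => h ((isSeq_some_iff_mem_actions hI hu).1 h'.2)

end IsFlow

theorem val_nonneg {v : G.Idx → ℝ} (hv : v ∈ G.VSF) (σ₁ σ₂ : SeqP) : 0 ≤ G.val v σ₁ σ₂ := by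
  unfold val
  split_ifs
  · exact hv.1 _
  · exact le_rfl

theorem relPair_some_left {I : Set (List ℕ)} {a : ℕ} {σ : SeqP} :
    G.RelPair (some (I, a)) σ ↔
      RelFor₁ σ I ∧ G.IsSeq 0 (some (I, a)) ∧ G.IsSeq 1 σ := by
  unfold RelPair RelFor₁
  rcases σ with _ | ⟨J, b⟩ <;> simp [and_comm, and_left_comm]

theorem relPair_some_right {I : Set (List ℕ)} {a : ℕ} {σ : SeqP} :
    G.RelPair σ (some (I, a)) ↔
      RelFor₂ σ I ∧ G.IsSeq 0 σ ∧ G.IsSeq 1 (some (I, a)) := by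
  unfold RelPair RelFor₂
  rcases σ with _ | ⟨J, b⟩ <;> simp [and_comm, and_assoc]

theorem isFlow_left {v : G.Idx → ℝ} (hv : v ∈ G.VSF) {σ : SeqP} (hσ : G.IsSeq 1 σ) :
    G.IsFlow 0 (fun I => RelFor₁ σ I) (fun τ => G.val v τ σ) where
  nonneg τ := val_nonneg hv τ σ
  eq_zero _ _ h := dif_neg fun h' => h ⟨(relPair_some_left.1 h').1, h'.1⟩
  sum_eq I hI hR u hu := hv.2.2.1 I hI σ hσ hR u hu

theorem isFlow_right {v : G.Idx → ℝ} (hv : v ∈ G.VSF) {σ : SeqP} (hσ : G.IsSeq 0 σ) :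
    G.IsFlow 1 (fun I => RelFor₂ σ I) (fun τ => G.val v σ τ) where
  nonneg τ := val_nonneg hv σ τ
  eq_zero _ _ h := dif_neg fun h' => h ⟨(relPair_some_right.1 h').1, h'.2.1⟩
  sum_eq I hI hR u hu := hv.2.2.2 I hI σ hσ hR u hu

theorem IsFlow.mono {R R' : Set (List ℕ) → Prop} {x : SeqP → ℝ} (hx : G.IsFlow i R x)
    (h : ∀ I, R I ↔ R' I) : G.IsFlow i R' x := by
  rwa [← show R = R' from funext fun I => propext (h I)]

theorem isFlow_left_none {v : G.Idx → ℝ} (hv : v ∈ G.VSF) :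
    G.IsFlow 0 (fun _ => True) (fun τ => G.val v τ none) :=
  (isFlow_left hv (Or.inl rfl)).mono fun _ => iff_true_intro (Or.inl rfl)

theorem isFlow_right_none {v : G.Idx → ℝ} (hv : v ∈ G.VSF) :
    G.IsFlow 1 (fun _ => True) (fun τ => G.val v none τ) :=
  (isFlow_right hv (Or.inl rfl)).mono fun _ => iff_true_intro (Or.inl rfl)

theorem val_le_right (hpr : G.PerfectRecall) {v : G.Idx → ℝ} (hv : v ∈ G.VSF) (σ₁ σ₂ : SeqP) :
    G.val v σ₁ σ₂ ≤ G.val v none σ₂ := by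
  by_cases h : G.RelPair σ₁ σ₂
  · exact (isFlow_left hv h.2.1).le_none hpr σ₁
  · rw [val, dif_neg h]
    exact val_nonneg hv _ _

theorem val_le_left (hpr : G.PerfectRecall) {v : G.Idx → ℝ} (hv : v ∈ G.VSF) (σ₁ σ₂ : SeqP) :
    G.val v σ₁ σ₂ ≤ G.val v σ₁ none := by
  by_cases h : G.RelPair σ₁ σ₂
  · exact (isFlow_right hv h.1).le_none hpr σ₂
  · rw [val, dif_neg h]
    exact val_nonneg hv _ _

theorem val_le_one (hpr : G.PerfectRecall) {v : G.Idx → ℝ} (hv : v ∈ G.VSF) (σ₁ σ₂ : SeqP) :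
    G.val v σ₁ σ₂ ≤ 1 :=
  (val_le_right hpr hv σ₁ σ₂).trans ((val_le_left hpr hv none σ₂).trans_eq hv.2.1)

theorem RelFor₁.parent (hpr : G.PerfectRecall) {σ : SeqP} {I I' : Set (List ℕ)} {a' : ℕ}
    (hI : G.InfoSet 0 I) (h : RelFor₁ σ I) (hp : G.parentSeq 0 I = some (I', a')) :
    RelFor₁ σ I' := by
  refine h.imp_right ?_
  rintro ⟨J, b, rfl, hJ⟩
  exact ⟨J, b, rfl, Connected.parent hpr hI hp hJ⟩

theorem RelFor₂.parent (hpr : G.PerfectRecall) {σ : SeqP} {I I' : Set (List ℕ)} {a' : ℕ}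
    (hI : G.InfoSet 1 I) (h : RelFor₂ σ I) (hp : G.parentSeq 1 I = some (I', a')) :
    RelFor₂ σ I' := by
  refine h.imp_right ?_
  rintro ⟨J, b, rfl, hJ⟩
  exact ⟨J, b, rfl, connected_comm.1 (Connected.parent hpr hI hp (connected_comm.1 hJ))⟩

theorem relPair_parentSeq_left (hpr : G.PerfectRecall) {σ : SeqP} {I : Set (List ℕ)}
    (hI : G.InfoSet 0 I) (hσ : G.IsSeq 1 σ) (h : RelFor₁ σ I) :
    G.RelPair (G.parentSeq 0 I) σ := by
  have hs := isSeq_parentSeq hpr hI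
  rcases hp : G.parentSeq 0 I with _ | ⟨I', a'⟩
  · exact ⟨Or.inl rfl, hσ, Or.inl rfl⟩
  · rw [hp] at hs
    exact relPair_some_left.2 ⟨h.parent hpr hI hp, hs, hσ⟩

theorem relPair_parentSeq_right (hpr : G.PerfectRecall) {σ : SeqP} {I : Set (List ℕ)}
    (hI : G.InfoSet 1 I) (hσ : G.IsSeq 0 σ) (h : RelFor₂ σ I) :
    G.RelPair σ (G.parentSeq 1 I) := by
  have hs := isSeq_parentSeq hpr hI
  rcases hp : G.parentSeq 1 I with _ | ⟨I', a'⟩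
  · exact ⟨hσ, Or.inl rfl, Or.inr (Or.inl rfl)⟩
  · rw [hp] at hs
    exact relPair_some_right.2 ⟨h.parent hpr hI hp, hσ, hs⟩

/-- The realization weights of a plan: the indicator of the sequences it is compatible with. -/
noncomputable def planInd (G : EFG) (i : Fin 2) (π : PlanT) (σ : SeqP) : ℝ :=
  if π ∈ G.PlanSet i σ then 1 else 0

theorem IsPlan.mem_planSet_parentSeq (hpr : G.PerfectRecall) {π : PlanT} (hπ : G.IsPlan i π)
    {I : Set (List ℕ)} (hI : G.InfoSet i I) :
    π ∈ G.PlanSet i (G.parentSeq i I) ↔ (π I).isSome = true := by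
  rw [hπ.2.1 I hI]
  obtain ⟨u, hu⟩ := hI.exists_mem
  have hall : (∀ u ∈ I, ∀ p ∈ G.playerSeq i u, π p.1 = some p.2) ↔
      ∀ p ∈ G.playerSeq i u, π p.1 = some p.2 :=
    ⟨fun h => h u hu, fun h v hv => by rwa [hpr i v u (hI.sim hv hu)]⟩
  rw [hall]
  rcases parentSeq_cases hpr hI hu with ⟨h, hs⟩ | ⟨I', a', u', h, hI', hu', -, hs⟩
  · rw [h, hs]
    simpa [PlanSet] using hπ
  · rw [h, hs]
    constructor
    · rintro ⟨-, h'⟩ p hp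
      rw [List.mem_append, List.mem_singleton] at hp
      rcases hp with hp | rfl
      · exact (hπ.2.1 I' hI').1 (by rw [h']; rfl) u' hu' p hp
      · exact h'
    · exact fun h' => ⟨hπ, h' (I', a') (by simp)⟩

theorem IsPlan.sum_planInd (hpr : G.PerfectRecall) {π : PlanT} (hπ : G.IsPlan i π)
    {I : Set (List ℕ)} (hI : G.InfoSet i I) {u : List ℕ} (hu : u ∈ I) :
    ∑ a ∈ G.actions u, G.planInd i π (some (I, a)) = G.planInd i π (G.parentSeq i I) := by
  simp only [planInd, hπ.mem_planSet_parentSeq hpr hI]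
  rcases h : π I with _ | a
  · simp [PlanSet, h]
  · have ha : a ∈ G.actions u :=
      (isSeq_some_iff_mem_actions hI hu).1 (isSeq_some.2 ⟨hI, hπ.2.2 I a hI h⟩)
    simp [PlanSet, h, hπ, ha]

/-- The deterministic correlation plan induced by a pair of plans. -/
noncomputable def detCorr (G : EFG) (q : PlanT × PlanT) : G.Idx → ℝ :=
  fun p => G.planInd 0 q.1 p.1.1 * G.planInd 1 q.2 p.1.2

theorem planInd_zero_or_one (π : PlanT) (σ : SeqP) :
    G.planInd i π σ = 0 ∨ G.planInd i π σ = 1 := by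
  unfold planInd
  split_ifs <;> simp

theorem val_detCorr {q : PlanT × PlanT} {σ₁ σ₂ : SeqP} (h : G.RelPair σ₁ σ₂) :
    G.val (G.detCorr q) σ₁ σ₂ = G.planInd 0 q.1 σ₁ * G.planInd 1 q.2 σ₂ := dif_pos h

/-- The set of deterministic correlation plans. -/
def detCorrs (G : EFG) : Set (G.Idx → ℝ) :=
  G.detCorr '' {q | G.IsPlan 0 q.1 ∧ G.IsPlan 1 q.2}

theorem detCorrs_subset_VSF (hpr : G.PerfectRecall) : G.detCorrs ⊆ G.VSF := by
  rintro _ ⟨q, ⟨h0, h1⟩, rfl⟩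
  refine ⟨?_, ?_, ?_, ?_⟩
  · intro p
    unfold detCorr planInd
    positivity
  · rw [val_detCorr ⟨Or.inl rfl, Or.inl rfl, Or.inl rfl⟩]
    simp [planInd, PlanSet, h0, h1]
  · intro I hI σ hσ hR u hu
    rw [val_detCorr (relPair_parentSeq_left hpr hI hσ hR), ← h0.sum_planInd hpr hI hu,
      Finset.sum_mul]
    refine Finset.sum_congr rfl fun a ha => val_detCorr ?_
    exact relPair_some_left.2 ⟨hR, (isSeq_some_iff_mem_actions hI hu).2 ha, hσ⟩
  · intro I hI σ hσ hR u hu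
    rw [val_detCorr (relPair_parentSeq_right hpr hI hσ hR), ← h1.sum_planInd hpr hI hu,
      Finset.mul_sum]
    refine Finset.sum_congr rfl fun a ha => val_detCorr ?_
    exact relPair_some_right.2 ⟨hR, hσ, (isSeq_some_iff_mem_actions hI hu).2 ha⟩

theorem mem_detCorrs_of_zero_one (hpr : G.PerfectRecall) {v : G.Idx → ℝ} (hv : v ∈ G.VSF)
    (h01 : ∀ p, v p = 0 ∨ v p = 1) : v ∈ G.detCorrs := by
  have hval : ∀ σ₁ σ₂, G.val v σ₁ σ₂ = 0 ∨ G.val v σ₁ σ₂ = 1 := by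
    intro σ₁ σ₂
    unfold val
    split_ifs
    · exact h01 _
    · exact Or.inl rfl
  obtain ⟨π₀, hπ₀, h₀⟩ := (isFlow_left_none hv).exists_plan hpr (fun σ => hval σ none) hv.2.1
  obtain ⟨π₁, hπ₁, h₁⟩ := (isFlow_right_none hv).exists_plan hpr (fun σ => hval none σ) hv.2.1
  have hind₀ : ∀ σ, G.planInd 0 π₀ σ = G.val v σ none := by
    rintro (_ | ⟨I, a⟩)
    · simp [planInd, PlanSet, hπ₀, hv.2.1]
    · rcases hval (some (I, a)) none with h | h <;>
        simp [planInd, PlanSet, hπ₀, h₀, h]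
  have hind₁ : ∀ σ, G.planInd 1 π₁ σ = G.val v none σ := by
    rintro (_ | ⟨I, a⟩)
    · simp [planInd, PlanSet, hπ₁, hv.2.1]
    · rcases hval none (some (I, a)) with h | h <;>
        simp [planInd, PlanSet, hπ₁, h₁, h]
  refine ⟨(π₀, π₁), ⟨hπ₀, hπ₁⟩, ?_⟩
  ext ⟨⟨σ₁, σ₂⟩, hp⟩
  have hvp : v ⟨(σ₁, σ₂), hp⟩ = G.val v σ₁ σ₂ := by rw [val, dif_pos hp]
  simp only [detCorr, hind₀, hind₁, hvp]
  have hle₁ := val_le_left hpr hv σ₁ σ₂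
  have hle₂ := val_le_right hpr hv σ₁ σ₂
  have hnn := val_nonneg hv σ₁ σ₂
  rcases hval σ₁ none with h | h
  · rw [h, zero_mul]
    linarith
  rcases hval none σ₂ with h' | h'
  · rw [h', mul_zero]
    linarith
  rw [h, h', one_mul]
  rcases σ₁ with _ | ⟨I, a⟩
  · exact h'.symm
  · refine (IsFlow.eq_one_of_le hpr (isFlow_left hv hp.2.1) ?_ h' (isFlow_left_none hv)
      (fun σ => val_le_one hpr hv σ none) (fun σ => val_le_left hpr hv σ σ₂)
      (isSeq_some.1 hp.1).1 (relPair_some_left.1 hp).1 h).symm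
    exact fun J J' a' hJ hR hpar => RelFor₁.parent hpr hJ hR hpar

theorem corrMap_apply {μ : PlanT × PlanT → ℝ} (p : G.Idx) :
    G.corrMap μ p = ∑ᶠ q, μ q * G.detCorr q p := by
  unfold corrMap
  refine finsum_congr fun q => ?_
  rw [finsum_eq_if]
  by_cases h0 : q.1 ∈ G.PlanSet 0 p.1.1 <;> by_cases h1 : q.2 ∈ G.PlanSet 1 p.1.2 <;>
    simp [detCorr, planInd, h0, h1]

theorem corrMap_eq_sum {μ : PlanT × PlanT → ℝ} {s : Finset (PlanT × PlanT)}
    (hs : Function.support μ ⊆ s) : G.corrMap μ = ∑ q ∈ s, μ q • G.detCorr q := by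
  ext p
  rw [corrMap_apply, finsum_eq_sum_of_support_subset _
    ((Function.support_mul_subset_left _ _).trans hs)]
  simp

theorem convex_corrPoly : Convex ℝ G.corrPoly := by
  rintro _ ⟨μ, hμ, rfl⟩ _ ⟨ν, hν, rfl⟩ a b ha hb hab
  obtain ⟨hμ0, hμf, hμp, hμ1⟩ := hμ
  obtain ⟨hν0, hνf, hνp, hν1⟩ := hν
  set s : Finset (PlanT × PlanT) := hμf.toFinset ∪ hνf.toFinset with hs
  have hμs : Function.support μ ⊆ s := by simp [hs]
  have hνs : Function.support ν ⊆ s := by simp [hs]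
  have hsupp : Function.support (fun q => a * μ q + b * ν q) ⊆ s := by
    intro q hq
    by_contra h
    have h1 : μ q = 0 := by_contra fun h' => h (hμs h')
    have h2 : ν q = 0 := by_contra fun h' => h (hνs h')
    exact hq (by simp [h1, h2])
  rw [finsum_eq_sum_of_support_subset _ hμs] at hμ1
  rw [finsum_eq_sum_of_support_subset _ hνs] at hν1
  refine ⟨fun q => a * μ q + b * ν q, ⟨?_, ?_, ?_, ?_⟩, ?_⟩
  · exact fun q => add_nonneg (mul_nonneg ha (hμ0 q)) (mul_nonneg hb (hν0 q))
  · exact s.finite_toSet.subset hsupp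
  · intro q hq
    by_cases h : μ q = 0
    · refine hνp q fun h' => hq ?_
      simp [h, h']
    · exact hμp q h
  · rw [finsum_eq_sum_of_support_subset _ hsupp, Finset.sum_add_distrib, ← Finset.mul_sum,
      ← Finset.mul_sum, hμ1, hν1, mul_one, mul_one, hab]
  · rw [corrMap_eq_sum hμs, corrMap_eq_sum hνs, corrMap_eq_sum hsupp, Finset.smul_sum,
      Finset.smul_sum, ← Finset.sum_add_distrib]
    exact Finset.sum_congr rfl fun q _ => by rw [add_smul, mul_smul, mul_smul]

theorem detCorrs_subset_corrPoly : G.detCorrs ⊆ G.corrPoly := by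
  rintro _ ⟨q, hq, rfl⟩
  have hsupp : Function.support (pointMass q) ⊆ ({q} : Finset (PlanT × PlanT)) := by
    intro r hr
    by_contra h
    exact hr (if_neg (by simpa using h))
  refine ⟨pointMass q, ⟨?_, ?_, ?_, ?_⟩, ?_⟩
  · intro r
    unfold pointMass
    split_ifs <;> simp
  · exact (Finset.finite_toSet _).subset hsupp
  · intro r hr
    have : r = q := by simpa using hsupp hr
    exact this ▸ hq
  · rw [finsum_eq_sum_of_support_subset _ hsupp]
    simp [pointMass]
  · rw [corrMap_eq_sum hsupp]
    simp [pointMass]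

/-- The polytope of correlation plans is the convex hull of the deterministic ones. -/
theorem corrPoly_eq_convexHull : G.corrPoly = convexHull ℝ G.detCorrs := by
  refine Set.Subset.antisymm ?_ (convexHull_min detCorrs_subset_corrPoly convex_corrPoly)
  rintro _ ⟨μ, ⟨h0, hf, hp, h1⟩, rfl⟩
  have hs : Function.support μ ⊆ hf.toFinset := by simp
  rw [finsum_eq_sum_of_support_subset _ hs] at h1
  rw [corrMap_eq_sum hs]
  refine (convex_convexHull ℝ _).sum_mem (fun q _ => h0 q) h1 fun q hq => ?_
  exact subset_convexHull ℝ _ ⟨q, hp q (by simpa using hq), rfl⟩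

theorem val_add_smul (v w : G.Idx → ℝ) (a b : ℝ) (σ₁ σ₂ : SeqP) :
    G.val (a • v + b • w) σ₁ σ₂ = a * G.val v σ₁ σ₂ + b * G.val w σ₁ σ₂ := by
  unfold val
  split_ifs <;> simp

theorem convex_VSF : Convex ℝ G.VSF := by
  rintro v ⟨hv0, hv1, hv2, hv3⟩ w ⟨hw0, hw1, hw2, hw3⟩ a b ha hb hab
  refine ⟨?_, ?_, ?_, ?_⟩
  · exact fun p => add_nonneg (mul_nonneg ha (hv0 p)) (mul_nonneg hb (hw0 p))
  · rw [val_add_smul, hv1, hw1, mul_one, mul_one, hab]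
  · intro I hI σ hσ hR u hu
    simp only [val_add_smul]
    rw [Finset.sum_add_distrib, ← Finset.mul_sum, ← Finset.mul_sum,
      hv2 I hI σ hσ hR u hu, hw2 I hI σ hσ hR u hu]
  · intro I hI σ hσ hR u hu
    simp only [val_add_smul]
    rw [Finset.sum_add_distrib, ← Finset.mul_sum, ← Finset.mul_sum,
      hv3 I hI σ hσ hR u hu, hw3 I hI σ hσ hR u hu]

theorem continuous_val (σ₁ σ₂ : SeqP) : Continuous fun v : G.Idx → ℝ => G.val v σ₁ σ₂ := by
  unfold val
  split_ifs
  · exact continuous_apply _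
  · exact continuous_const

theorem isClosed_VSF : IsClosed G.VSF := by
  have hc := continuous_val (G := G)
  have hs (s : Finset ℕ) (f g : ℕ → SeqP) :
      Continuous fun v : G.Idx → ℝ => ∑ a ∈ s, G.val v (f a) (g a) :=
    continuous_finsetSum _ fun a _ => hc _ _
  simp only [VSF, Set.ofPred_and, Set.ofPred_forall]
  refine IsClosed.inter ?_ (IsClosed.inter ?_ (IsClosed.inter ?_ ?_))
  · exact isClosed_iInter fun p => isClosed_le continuous_const (continuous_apply p)
  · exact isClosed_eq (hc _ _) continuous_const
  · exact isClosed_iInter fun I => isClosed_iInter fun _ => isClosed_iInter fun σ =>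
      isClosed_iInter fun _ => isClosed_iInter fun _ => isClosed_iInter fun u =>
        isClosed_iInter fun _ => isClosed_eq (hs _ _ _) (hc _ _)
  · exact isClosed_iInter fun I => isClosed_iInter fun _ => isClosed_iInter fun σ =>
      isClosed_iInter fun _ => isClosed_iInter fun _ => isClosed_iInter fun u =>
        isClosed_iInter fun _ => isClosed_eq (hs _ _ _) (hc _ _)

theorem finite_isSeq (G : EFG) (i : Fin 2) : {σ | G.IsSeq i σ}.Finite := by
  refine ((G.H.finite_toSet.image fun w : List ℕ =>
    (some ({v | G.sim i w.dropLast v}, w.getLast?.getD 0) : SeqP)).insert none).subset ?_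
  rintro (_ | ⟨I, a⟩) h
  · exact Set.mem_insert _ _
  · obtain ⟨hI, u, hu, ha⟩ := isSeq_some.1 h
    refine Set.mem_insert_of_mem _ ⟨u ++ [a], ha, ?_⟩
    simp [← hI.eq_class hu]

instance finite_idx (G : EFG) : Finite G.Idx := by
  refine Set.Finite.to_subtype (s := {p : SeqP × SeqP | G.RelPair p.1 p.2}) ?_
  exact ((finite_isSeq G 0).prod (finite_isSeq G 1)).subset fun p hp => ⟨hp.1, hp.2.1⟩

theorem isCompact_VSF (hpr : G.PerfectRecall) : IsCompact G.VSF := by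
  refine (isCompact_univ_pi (s := fun _ : G.Idx => Set.Icc (0 : ℝ) 1)
    fun _ => isCompact_Icc).of_isClosed_subset isClosed_VSF ?_
  intro v hv p _
  refine ⟨hv.1 p, ?_⟩
  have := val_le_one hpr hv p.1.1 p.1.2
  rwa [val, dif_pos p.2] at this

theorem finite_zero_one {ι : Type*} [Finite ι] :
    {v : ι → ℝ | ∀ p, v p = 0 ∨ v p = 1}.Finite := by
  refine (Set.Finite.pi (t := fun _ : ι => ({0, 1} : Set ℝ))
    fun _ => Set.toFinite _).subset ?_
  exact fun v hv p _ => hv p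

end EFG

/-- In a two-player perfect-recall extensive-form game, `Ξ = 𝒱`
if and only if every extreme point of `𝒱` has all coordinates in `{0, 1}`. -/
theorem corrPoly_eq_VSF_iff_extremePoints_zero_one (G : EFG) (hpr : G.PerfectRecall) :
    G.corrPoly = G.VSF ↔
      ∀ v ∈ G.VSF.extremePoints ℝ, ∀ p : G.Idx, v p = 0 ∨ v p = 1 := by
  constructor
  · intro h v hv p
    rw [← h, EFG.corrPoly_eq_convexHull] at hv
    obtain ⟨q, -, rfl⟩ := extremePoints_convexHull_subset hv
    rcases EFG.planInd_zero_or_one (G := G) (i := 0) q.1 p.1.1 with h0 | h0 <;>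
      rcases EFG.planInd_zero_or_one (G := G) (i := 1) q.2 p.1.2 with h1 | h1 <;>
      simp [EFG.detCorr, h0, h1]
  · intro h
    rw [EFG.corrPoly_eq_convexHull]
    refine Set.Subset.antisymm
      (convexHull_min (EFG.detCorrs_subset_VSF hpr) EFG.convex_VSF) ?_
    have hfin : (G.VSF.extremePoints ℝ).Finite := EFG.finite_zero_one.subset h
    rw [← closure_convexHull_extremePoints (EFG.isCompact_VSF hpr) EFG.convex_VSF,
      hfin.isClosed_convexHull ℝ |>.closure_eq]
    exact convexHull_mono fun v hv => EFG.mem_detCorrs_of_zero_one hpr hv.1 (h v hv)
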